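/- Let μ ∈ I_v, set r = ξ(ρ(μ)), and let q ≥ v. For every p ∈ R_q(μ+Γ), the circular interval <r,p> is contained in R_q(μ+Γ). In particular, R_q(μ+Γ) is a circular interval. -/

import Mathlib

/-- The numerical semigroup `Γ = {a·n + b·m : a, b ∈ ℕ}`. -/
def Gam (n m : ℕ) : Set ℕ := {x | ∃ a b : ℕ, x = a * n + b * m}

/-- `Λ` is a `Γ`-semimodule: a nonempty subset of `ℕ` with `Λ + Γ ⊆ Λ`. -/
def IsSemimodule (n m : ℕ) (Λ : Set ℕ) : Prop :=
  Λ.Nonempty ∧ ∀ x ∈ Λ, ∀ g ∈ Gam n m, x + g ∈ Λ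

/-- The translate `c + Γ`. -/
def GamShift (n m c : ℕ) : Set ℕ := {x | ∃ g ∈ Gam n m, x = c + g}

/-- For a sequence `lam : ℕ → ℕ` (where `lam i` encodes the paper's `λ_{i-1}`),
`LamUnion n m lam j = (lam 0 + Γ) ∪ ⋯ ∪ (lam j + Γ)`; the paper's `Λ_k` is
`LamUnion n m lam (k+1)`. -/
def LamUnion (n m : ℕ) (lam : ℕ → ℕ) (j : ℕ) : Set ℕ :=
  {x | ∃ i ≤ j, x ∈ GamShift n m (lam i)}

/-- `lam 0, lam 1, …, lam (s+1)` encodes the (strictly increasing) basis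
`(λ_{-1}, λ_0, …, λ_s)` of `Λ`: each `λ_j ∉ Λ_{j-1}` for `0 ≤ j ≤ s` and `Λ = Λ_s`. -/
def IsBasisOf (n m : ℕ) (Λ : Set ℕ) (s : ℕ) (lam : ℕ → ℕ) : Prop :=
  (∀ i j, i < j → j ≤ s + 1 → lam i < lam j) ∧
  (∀ j, 1 ≤ j → j ≤ s + 1 → lam j ∉ LamUnion n m lam (j - 1)) ∧
  Λ = LamUnion n m lam (s + 1)

/-- The axes: `axisU 0 = λ_{-1}` and, in the paper's indexing,
`axisU i = min (Λ_{i-2} ∩ (λ_{i-1} + Γ))` for `1 ≤ i ≤ s+1`. -/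
noncomputable def axisU (n m : ℕ) (lam : ℕ → ℕ) : ℕ → ℕ
  | 0 => lam 0
  | i + 1 => sInf (LamUnion n m lam i ∩ GamShift n m (lam (i + 1)))

/-- The conductor of a subset of `ℕ`: the least `c` such that every `x ≥ c` belongs. -/
noncomputable def conductorOf (Λ : Set ℕ) : ℕ := sInf {c | ∀ x, c ≤ x → x ∈ Λ}

/-- The critical orders (shifted indexing: `critT i` is the paper's `t_{i-1}`):
`t_{-1} = n`, `t_0 = m`, and `t_i = t_{i-1} + u_i - λ_{i-1}` for `i ≥ 1`. -/
noncomputable def critT (n m : ℕ) (lam : ℕ → ℕ) : ℕ → ℕ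
  | 0 => n
  | 1 => m
  | i + 2 => critT n m lam (i + 1) + (axisU n m lam (i + 1) - lam (i + 1))

/-- The first limit `ℓ1 = min {p : n·p + λ_s ∈ Λ_{s-1}}`. -/
noncomputable def limit1 (n m s : ℕ) (lam : ℕ → ℕ) : ℕ :=
  sInf {p | n * p + lam (s + 1) ∈ LamUnion n m lam s}

/-- The second limit `ℓ2 = min {q : m·q + λ_s ∈ Λ_{s-1}}`. -/
noncomputable def limit2 (n m s : ℕ) (lam : ℕ → ℕ) : ℕ :=
  sInf {q | m * q + lam (s + 1) ∈ LamUnion n m lam s}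

/-- The top `q1`, determined by `λ_s + n·ℓ1 ∈ I_{q1}` where `I_q = [nq, n(q+1))`. -/
noncomputable def top1 (n m s : ℕ) (lam : ℕ → ℕ) : ℕ := (lam (s + 1) + n * limit1 n m s lam) / n

/-- The top `q2`, determined by `λ_s + m·ℓ2 ∈ I_{q2}`. -/
noncomputable def top2 (n m s : ℕ) (lam : ℕ → ℕ) : ℕ := (lam (s + 1) + m * limit2 n m s lam) / n

/-- The main top `Q_Λ = max (q1, q2)`. -/
noncomputable def mainTop (n m s : ℕ) (lam : ℕ → ℕ) : ℕ := max (top1 n m s lam) (top2 n m s lam)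

/-- The interval `I_q = {nq, nq+1, …, n(q+1)-1}`. -/
def Iq (n q : ℕ) : Set ℕ := {x | n * q ≤ x ∧ x < n * (q + 1)}

/-- The `q`-level set `R_q(S) = ξ(ρ(S ∩ I_q)) ⊆ {0,…,n-1}`, where `ρ : ℤ → ℤ/nℤ` and
`ξ : ℤ/nℤ → {0,…,n-1}` is determined by `ξ⁻¹(k) = ρ(k·m)`. -/
def Rlevel (n m : ℕ) (S : Set ℕ) (q : ℕ) : Set ℕ :=
  {r | r < n ∧ ∃ x ∈ S, x ∈ Iq n q ∧ r * m ≡ x [MOD n]}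

/-- The circular interval `<r,s>` inside `{0,…,n-1}`. -/
def CircInt (n r s : ℕ) : Set ℕ :=
  if r ≤ s then Set.Icc r s else Set.Icc r (n - 1) ∪ Set.Icc 0 s

/-- A subset of `{0,…,n-1}` is a circular interval if it equals some `<r,s>`. -/
def IsCircInt (n : ℕ) (A : Set ℕ) : Prop := ∃ r s, r < n ∧ s < n ∧ A = CircInt n r s

/-- The length `d` of the circular path from `r` to `p`, i.e. the `d < n` with `p ≡ r + d`
modulo `n`. -/
def circDist (n r p : ℕ) : ℕ := if r ≤ p then p - r else p + n - r

theorem mem_CircInt_iff {n r s p : ℕ} (hr : r < n) (hs : s < n) :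
    p ∈ CircInt n r s ↔ p < n ∧ circDist n r p ≤ circDist n r s := by
  unfold CircInt circDist
  split_ifs <;> simp only [Set.mem_union, Set.mem_Icc] <;> omega

theorem circDist_lt {n r p : ℕ} (hr : r < n) (hp : p < n) : circDist n r p < n := by
  unfold circDist
  split_ifs <;> omega

theorem add_circDist_modEq {n r : ℕ} (hr : r < n) (p : ℕ) :
    r + circDist n r p ≡ p [MOD n] := by
  unfold circDist
  split_ifs with h
  · rw [Nat.add_sub_cancel' h]
  · rw [Nat.add_sub_cancel' (by omega)]
    exact Nat.add_modEq_right

theorem exists_circDist_eq {n r d : ℕ} (hr : r < n) (hd : d < n) :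
    ∃ s < n, circDist n r s = d := by
  unfold circDist
  by_cases h : r + d < n
  · exact ⟨r + d, h, by rw [if_pos] <;> omega⟩
  · exact ⟨r + d - n, by omega, by rw [if_neg] <;> omega⟩

theorem mem_Rlevel_GamShift_iff {n m μ r q p : ℕ} (hcop : Nat.Coprime n m) (hr : r < n)
    (hrμ : r * m ≡ μ [MOD n]) :
    p ∈ Rlevel n m (GamShift n m μ) q ↔
      p < n ∧ μ + circDist n r p * m < n * (q + 1) := by
  have hn : 0 < n := by omega
  constructor
  · rintro ⟨hp, x, ⟨g, ⟨a, b, rfl⟩, rfl⟩, ⟨-, hlt⟩, hx⟩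
    refine ⟨hp, lt_of_le_of_lt ?_ hlt⟩
    have hmul : (r + circDist n r p) * m ≡ (r + b) * m [MOD n] := by
      calc (r + circDist n r p) * m ≡ p * m [MOD n] :=
            (add_circDist_modEq hr p).mul_right m
        _ ≡ μ + (a * n + b * m) [MOD n] := hx
        _ = μ + b * m + a * n := by ring
        _ ≡ μ + b * m [MOD n] := by simp [Nat.ModEq]
        _ ≡ r * m + b * m [MOD n] := hrμ.symm.add_right _
        _ = (r + b) * m := by ring
    have hb : circDist n r p ≡ b [MOD n] :=
      Nat.ModEq.add_left_cancel' r (Nat.ModEq.cancel_right_of_coprime hcop hmul)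
    have hle : circDist n r p ≤ b := by
      rw [← Nat.mod_eq_of_lt (circDist_lt hr hp), hb]
      exact Nat.mod_le b n
    have := Nat.mul_le_mul_right m hle
    omega
  · rintro ⟨hp, hlt⟩
    set y := μ + circDist n r p * m with hy
    have hdiv : y / n ≤ q := Nat.lt_succ_iff.mp (Nat.div_lt_of_lt_mul hlt)
    have hqn : (q - y / n) * n + n * (y / n) = n * q := by
      rw [mul_comm n (y / n), ← add_mul, Nat.sub_add_cancel hdiv, mul_comm]
    have hmod := Nat.div_add_mod y n
    have hmod_lt := Nat.mod_lt y hn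
    refine ⟨hp, y + (q - y / n) * n,
      ⟨(q - y / n) * n + circDist n r p * m, ⟨_, _, rfl⟩, by omega⟩,
      ⟨by omega, by rw [mul_add]; omega⟩, ?_⟩
    calc p * m ≡ (r + circDist n r p) * m [MOD n] :=
          ((add_circDist_modEq hr p).mul_right m).symm
      _ = r * m + circDist n r p * m := by ring
      _ ≡ y [MOD n] := hrμ.add_right _
      _ ≡ y + (q - y / n) * n [MOD n] := by simp [Nat.ModEq]

/-- Let `μ ∈ I_v`, `r = ξ(ρ(μ))` and `q ≥ v`. For every `p ∈ R_q(μ+Γ)`, the circular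
interval `<r,p>` is contained in `R_q(μ+Γ)`; in particular `R_q(μ+Γ)` is a circular
interval. -/
theorem level_set_circular (n m : ℕ) (hn : 2 ≤ n) (hnm : n < m) (hcop : Nat.Coprime n m)
    (μ v : ℕ) (hμ : μ ∈ Iq n v) (r : ℕ) (hr : r < n) (hrμ : r * m ≡ μ [MOD n])
    (q : ℕ) (hq : v ≤ q) :
    (∀ p ∈ Rlevel n m (GamShift n m μ) q,
      CircInt n r p ⊆ Rlevel n m (GamShift n m μ) q) ∧
    IsCircInt n (Rlevel n m (GamShift n m μ) q) := by
  have hmem (p : ℕ) := mem_Rlevel_GamShift_iff (q := q) (p := p) hcop hr hrμ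
  have hμq : μ < n * (q + 1) := lt_of_lt_of_le hμ.2 (Nat.mul_le_mul_left n (by omega))
  have hm : 0 < m := by omega
  constructor
  · intro p hp t ht
    obtain ⟨hpn, hplt⟩ := (hmem p).1 hp
    obtain ⟨htn, hle⟩ := (mem_CircInt_iff hr hpn).1 ht
    have := Nat.mul_le_mul_right m hle
    exact (hmem t).2 ⟨htn, by omega⟩
  · obtain ⟨s, hs, hds⟩ := exists_circDist_eq (d := min (n - 1) ((n * (q + 1) - 1 - μ) / m)) hr
      (by omega)
    refine ⟨r, s, hr, hs, Set.ext fun p => ?_⟩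
    rw [hmem, mem_CircInt_iff hr hs, hds, le_min_iff, Nat.le_div_iff_mul_le hm]
    refine and_congr_right fun hp => ?_
    have := circDist_lt hr hp
    omega
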